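/- arXiv:1302.3271 — 2 statements merged into one kernel-verified Lean document; each statement's English description precedes it below -/
import Mathlib

section
/- Every generalized isotropic Berwald metric is a generalized Douglas–Weyl metric; that is, if F is a generalized isotropic Berwald metric with data (μ, λ), then h^i_α (D^α_{jkl|m} y^m) = 0 at every point of U × (ℝ^n ∖ {0}). -/
/-!  Common setup: Finsler metrics on an open set `U ⊆ ℝⁿ`, in coordinates. -/

noncomputable section

open scoped BigOperators

/-- Points/vectors of `ℝⁿ`, as functions `Fin n → ℝ`. -/
abbrev Pt (n : ℕ) := Fin n → ℝ

variable {n : ℕ}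

/-- Partial derivative in the fiber variable `y`, direction `yⁱ`. -/
def pdy (f : Pt n → Pt n → ℝ) (i : Fin n) : Pt n → Pt n → ℝ :=
  fun x y => fderiv ℝ (fun y' => f x y') y (Pi.single i 1)

/-- Partial derivative in the base variable `x`, direction `xⁱ`. -/
def pdx (f : Pt n → Pt n → ℝ) (i : Fin n) : Pt n → Pt n → ℝ :=
  fun x y => fderiv ℝ (fun x' => f x' y) x (Pi.single i 1)

/-- `F²`. -/
def F2 (F : Pt n → Pt n → ℝ) : Pt n → Pt n → ℝ := fun x y => (F x y) ^ 2

/-- Fundamental tensor `g_{ij} = (1/2) ∂²(F²)/∂yⁱ∂yʲ`. -/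
def gLow (F : Pt n → Pt n → ℝ) (i j : Fin n) : Pt n → Pt n → ℝ :=
  fun x y => (1 / 2 : ℝ) * pdy (pdy (F2 F) j) i x y

/-- The fundamental tensor as a matrix. -/
def gMat (F : Pt n → Pt n → ℝ) (x y : Pt n) : Matrix (Fin n) (Fin n) ℝ :=
  Matrix.of fun i j => gLow F i j x y

/-- Inverse fundamental tensor `g^{ij}`. -/
def gInv (F : Pt n → Pt n → ℝ) (i j : Fin n) : Pt n → Pt n → ℝ :=
  fun x y => (gMat F x y)⁻¹ i j

/-- Lowered fiber variable `y_i := g_{ij} yʲ`. -/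
def yLow (F : Pt n → Pt n → ℝ) (i : Fin n) : Pt n → Pt n → ℝ :=
  fun x y => ∑ j, gLow F i j x y * y j

/-- `ℓⁱ := yⁱ / F`. -/
def ell (F : Pt n → Pt n → ℝ) (i : Fin n) : Pt n → Pt n → ℝ :=
  fun x y => y i / F x y

/-- Angular metric `h_{ij} := g_{ij} - F⁻² y_i y_j`. -/
def hLow (F : Pt n → Pt n → ℝ) (i j : Fin n) : Pt n → Pt n → ℝ :=
  fun x y => gLow F i j x y - yLow F i x y * yLow F j x y / (F x y) ^ 2

/-- `hⁱ_j := δⁱ_j - F⁻² yⁱ y_j`. -/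
def hUp (F : Pt n → Pt n → ℝ) (i j : Fin n) : Pt n → Pt n → ℝ :=
  fun x y => (if i = j then (1 : ℝ) else 0) - y i * yLow F j x y / (F x y) ^ 2

/-- Cartan torsion `C_{ijk} := (1/4) ∂³(F²)/∂yⁱ∂yʲ∂yᵏ`. -/
def Cartan (F : Pt n → Pt n → ℝ) (i j k : Fin n) : Pt n → Pt n → ℝ :=
  fun x y => (1 / 4 : ℝ) * pdy (pdy (pdy (F2 F) k) j) i x y

/-- Mean Cartan torsion `I_k := g^{ij} C_{ijk}`. -/
def mCartan (F : Pt n → Pt n → ℝ) (k : Fin n) : Pt n → Pt n → ℝ :=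
  fun x y => ∑ i, ∑ j, gInv F i j x y * Cartan F i j k x y

/-- Spray coefficients `Gⁱ`. -/
def Gspray (F : Pt n → Pt n → ℝ) (i : Fin n) : Pt n → Pt n → ℝ :=
  fun x y => (1 / 4 : ℝ) * ∑ l, gInv F i l x y *
    ((∑ k, y k * pdx (pdy (F2 F) l) k x y) - pdx (F2 F) l x y)

/-- Berwald curvature `Bⁱ_{jkl} := ∂³Gⁱ/∂yʲ∂yᵏ∂yˡ`. -/
def Bcurv (F : Pt n → Pt n → ℝ) (i j k l : Fin n) : Pt n → Pt n → ℝ :=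
  pdy (pdy (pdy (Gspray F i) l) k) j

/-- Mean Berwald curvature `E_{jk} := (1/2) Bᵐ_{jkm}`. -/
def Ecurv (F : Pt n → Pt n → ℝ) (j k : Fin n) : Pt n → Pt n → ℝ :=
  fun x y => (1 / 2 : ℝ) * ∑ m, Bcurv F m j k m x y

/-- Nonlinear connection `Nⁱ_j := ∂Gⁱ/∂yʲ`. -/
def Ncon (F : Pt n → Pt n → ℝ) (i j : Fin n) : Pt n → Pt n → ℝ :=
  pdy (Gspray F i) j

/-- Berwald connection coefficients `Γⁱ_{jk} := ∂²Gⁱ/∂yʲ∂yᵏ`. -/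
def Γcon (F : Pt n → Pt n → ℝ) (i j k : Fin n) : Pt n → Pt n → ℝ :=
  pdy (pdy (Gspray F i) k) j

/-- Horizontal (Berwald) covariant derivative of a scalar. -/
def hD0 (F : Pt n → Pt n → ℝ) (f : Pt n → Pt n → ℝ) (m : Fin n) : Pt n → Pt n → ℝ :=
  fun x y => pdx f m x y - ∑ r, Ncon F r m x y * pdy f r x y

/-- Horizontal covariant derivative of a covariant 2-tensor. -/
def hD2 (F : Pt n → Pt n → ℝ) (T : Fin n → Fin n → Pt n → Pt n → ℝ) (j k m : Fin n) :
    Pt n → Pt n → ℝ :=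
  fun x y => hD0 F (T j k) m x y - (∑ r, T r k x y * Γcon F r j m x y)
    - ∑ r, T j r x y * Γcon F r k m x y

/-- Horizontal covariant derivative of a covariant 3-tensor. -/
def hD3 (F : Pt n → Pt n → ℝ) (T : Fin n → Fin n → Fin n → Pt n → Pt n → ℝ) (i j k m : Fin n) :
    Pt n → Pt n → ℝ :=
  fun x y => hD0 F (T i j k) m x y - (∑ r, T r j k x y * Γcon F r i m x y)
    - (∑ r, T i r k x y * Γcon F r j m x y) - ∑ r, T i j r x y * Γcon F r k m x y

/-- Horizontal covariant derivative of a (1,3)-tensor `Tⁱ_{jkl}`. -/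
def hD13 (F : Pt n → Pt n → ℝ) (T : Fin n → Fin n → Fin n → Fin n → Pt n → Pt n → ℝ)
    (i j k l m : Fin n) : Pt n → Pt n → ℝ :=
  fun x y => hD0 F (T i j k l) m x y + (∑ r, T r j k l x y * Γcon F i r m x y)
    - (∑ r, T i r k l x y * Γcon F r j m x y) - (∑ r, T i j r l x y * Γcon F r k m x y)
    - ∑ r, T i j k r x y * Γcon F r l m x y

/-- Landsberg curvature `L_{ijk} := C_{ijk|m} yᵐ`. -/
def Land (F : Pt n → Pt n → ℝ) (i j k : Fin n) : Pt n → Pt n → ℝ :=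
  fun x y => ∑ m, hD3 F (Cartan F) i j k m x y * y m

/-- Stretch curvature `Σ_{ijkl} := 2(L_{ijk|l} - L_{ijl|k})`. -/
def Stretch (F : Pt n → Pt n → ℝ) (i j k l : Fin n) : Pt n → Pt n → ℝ :=
  fun x y => 2 * (hD3 F (Land F) i j k l x y - hD3 F (Land F) i j l k x y)

/-- Douglas tensor `Dⁱ_{jkl}`. -/
def Douglas (F : Pt n → Pt n → ℝ) (i j k l : Fin n) : Pt n → Pt n → ℝ :=
  fun x y => Bcurv F i j k l x y - (2 / ((n : ℝ) + 1)) *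
    (Ecurv F j k x y * (if i = l then (1 : ℝ) else 0)
      + Ecurv F j l x y * (if i = k then (1 : ℝ) else 0)
      + Ecurv F k l x y * (if i = j then (1 : ℝ) else 0)
      + pdy (Ecurv F j k) l x y * y i)

/-- Riemann curvature `Rⁱ_k`. -/
def RiemK (F : Pt n → Pt n → ℝ) (i k : Fin n) : Pt n → Pt n → ℝ :=
  fun x y => 2 * pdx (Gspray F i) k x y - (∑ j, y j * pdx (pdy (Gspray F i) k) j x y)
    + 2 * (∑ j, Gspray F j x y * Γcon F i j k x y) - ∑ j, Ncon F i j x y * Ncon F j k x y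

/-- `Rⁱ_{jkl} := (1/3) ∂/∂yʲ (∂Rⁱ_k/∂yˡ - ∂Rⁱ_l/∂yᵏ)`. -/
def Riem4 (F : Pt n → Pt n → ℝ) (i j k l : Fin n) : Pt n → Pt n → ℝ :=
  fun x y => (1 / 3 : ℝ) *
    pdy (fun x' y' => pdy (RiemK F i k) l x' y' - pdy (RiemK F i l) k x' y') j x y

/-- `F` is R-quadratic on `U`: `Rⁱ_{jkl}(x,y)` is independent of `y`. -/
def RQuadratic (U : Set (Pt n)) (F : Pt n → Pt n → ℝ) : Prop :=
  ∀ x ∈ U, ∀ y y' : Pt n, y ≠ 0 → y' ≠ 0 →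
    ∀ i j k l, Riem4 F i j k l x y = Riem4 F i j k l x y'

/-- A Finsler metric on a connected open set `U ⊆ ℝⁿ` (`n ≥ 2`). -/
structure IsFinslerMetric (U : Set (Pt n)) (F : Pt n → Pt n → ℝ) : Prop where
  dim : 2 ≤ n
  isOpen : IsOpen U
  connected : IsConnected U
  smooth : ContDiffOn ℝ (⊤ : ℕ∞) (Function.uncurry F) (U ×ˢ {y : Pt n | y ≠ 0})
  pos : ∀ x ∈ U, ∀ y : Pt n, y ≠ 0 → 0 < F x y
  homog : ∀ x ∈ U, ∀ y : Pt n, y ≠ 0 → ∀ t : ℝ, 0 < t → F x (t • y) = t * F x y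
  posdef : ∀ x ∈ U, ∀ y : Pt n, y ≠ 0 → (gMat F x y).PosDef

/-- `F` is a generalized isotropic Berwald metric on `U` with data `(μ, λ)`. -/
structure IsGIB (U : Set (Pt n)) (F μ lam : Pt n → Pt n → ℝ) : Prop where
  finsler : IsFinslerMetric U F
  smooth_mu : ContDiffOn ℝ (⊤ : ℕ∞) (Function.uncurry μ) (U ×ˢ {y : Pt n | y ≠ 0})
  smooth_lam : ContDiffOn ℝ (⊤ : ℕ∞) (Function.uncurry lam) (U ×ˢ {y : Pt n | y ≠ 0})
  homog_mu : ∀ x ∈ U, ∀ y : Pt n, y ≠ 0 → ∀ t : ℝ, 0 < t → μ x (t • y) = μ x y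
  homog_lam : ∀ x ∈ U, ∀ y : Pt n, y ≠ 0 → ∀ t : ℝ, 0 < t → lam x (t • y) = t⁻¹ * lam x y
  berwald : ∀ x ∈ U, ∀ y : Pt n, y ≠ 0 → ∀ i j k l,
    Bcurv F i j k l x y = μ x y * Cartan F j k l x y * ell F i x y
      + lam x y * (hUp F i j x y * hLow F k l x y + hUp F i k x y * hLow F j l x y
        + hUp F i l x y * hLow F j k x y)

end

open scoped ContDiff

/-- Joint smoothness of `f` on the slit bundle `U × (ℝⁿ ∖ {0})`. -/
def SlitSmooth {n : ℕ} (U : Set (Pt n)) (f : Pt n → Pt n → ℝ) : Prop :=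
  ContDiffOn ℝ ∞ (Function.uncurry f) (U ×ˢ {y : Pt n | y ≠ 0})

/-- Positive homogeneity of degree `d` in the fiber variable. -/
def SlitHomog {n : ℕ} (U : Set (Pt n)) (d : ℕ) (f : Pt n → Pt n → ℝ) : Prop :=
  ∀ x ∈ U, ∀ y : Pt n, y ≠ 0 → ∀ t : ℝ, 0 < t → f x (t • y) = t ^ d * f x y

section Slit

variable {n : ℕ} {U : Set (Pt n)} {f g : Pt n → Pt n → ℝ} {x y : Pt n} {d : ℕ}

lemma isOpen_slit (hU : IsOpen U) : IsOpen (U ×ˢ {y : Pt n | y ≠ 0}) :=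
  hU.prod isOpen_ne

lemma fderiv_fun_const_smul_field (c : ℝ) (f : Pt n → ℝ) (x : Pt n) :
    fderiv ℝ (fun z => c • f z) x = c • fderiv ℝ f x :=
  congrFun (fderiv_const_smul_field (𝕜 := ℝ) (f := f) c) x

lemma pdy_congr (h : ∀ y : Pt n, y ≠ 0 → f x y = g x y) (hy : y ≠ 0) (i : Fin n) :
    pdy f i x y = pdy g i x y := by
  have : (fun y' => f x y') =ᶠ[nhds y] fun y' => g x y' := by
    filter_upwards [isOpen_ne.mem_nhds hy] with z hz using h z hz
  simp only [pdy, this.fderiv_eq]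

lemma pdx_congr (hU : IsOpen U) (hx : x ∈ U) (h : ∀ x ∈ U, f x y = g x y) (i : Fin n) :
    pdx f i x y = pdx g i x y := by
  have : (fun x' => f x' y) =ᶠ[nhds x] fun x' => g x' y := by
    filter_upwards [hU.mem_nhds hx] with z hz using h z hz
  simp only [pdx, this.fderiv_eq]

namespace SlitSmooth

lemma contDiffAt (hU : IsOpen U) (hf : SlitSmooth U f) (hx : x ∈ U) (hy : y ≠ 0) :
    ContDiffAt ℝ ∞ (Function.uncurry f) (x, y) :=
  ContDiffOn.contDiffAt hf ((isOpen_slit hU).mem_nhds ⟨hx, hy⟩)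

lemma contDiffAt_right (hU : IsOpen U) (hf : SlitSmooth U f) (hx : x ∈ U) (hy : y ≠ 0) :
    ContDiffAt ℝ ∞ (fun y' => f x y') y :=
  (hf.contDiffAt hU hx hy).comp y (contDiffAt_const.prodMk contDiffAt_id)

lemma differentiableAt_right (hU : IsOpen U) (hf : SlitSmooth U f) (hx : x ∈ U) (hy : y ≠ 0) :
    DifferentiableAt ℝ (fun y' => f x y') y :=
  (hf.contDiffAt_right hU hx hy).differentiableAt (by simp)

lemma fderiv_apply (hU : IsOpen U) (hf : SlitSmooth U f) (v : Pt n × Pt n) :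
    SlitSmooth U fun x y => fderiv ℝ (Function.uncurry f) (x, y) v :=
  (ContDiffOn.fderiv_of_isOpen hf (isOpen_slit hU) (m := ∞) (by simp)).clm_apply
    contDiffOn_const

lemma congr (hf : SlitSmooth U f) (h : ∀ x ∈ U, ∀ y : Pt n, y ≠ 0 → g x y = f x y) :
    SlitSmooth U g :=
  ContDiffOn.congr hf fun p hp => h p.1 hp.1 p.2 hp.2

lemma pdy (hU : IsOpen U) (hf : SlitSmooth U f) (i : Fin n) : SlitSmooth U (pdy f i) := by
  refine (hf.fderiv_apply hU (0, Pi.single i 1)).congr fun x hx y hy => ?_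
  have h := ((hf.contDiffAt hU hx hy).differentiableAt (by simp)).hasFDerivAt.comp y
    ((hasFDerivAt_const x y).prodMk (hasFDerivAt_id y))
  exact congrArg (fun L => L (Pi.single i 1)) h.fderiv

lemma pdx (hU : IsOpen U) (hf : SlitSmooth U f) (i : Fin n) : SlitSmooth U (pdx f i) := by
  refine (hf.fderiv_apply hU (Pi.single i 1, 0)).congr fun x hx y hy => ?_
  have h := ((hf.contDiffAt hU hx hy).differentiableAt (by simp)).hasFDerivAt.comp x
    ((hasFDerivAt_id (𝕜 := ℝ) x).prodMk (hasFDerivAt_const y x))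
  exact congrArg (fun L => L (Pi.single i 1)) h.fderiv

lemma const (c : ℝ) : SlitSmooth U fun _ _ => c := contDiffOn_const

lemma coord (i : Fin n) : SlitSmooth U fun _ y => y i :=
  ((contDiff_apply ℝ ℝ i).comp contDiff_snd).contDiffOn

lemma add (hf : SlitSmooth U f) (hg : SlitSmooth U g) : SlitSmooth U fun x y => f x y + g x y :=
  ContDiffOn.add hf hg

lemma sub (hf : SlitSmooth U f) (hg : SlitSmooth U g) : SlitSmooth U fun x y => f x y - g x y :=
  ContDiffOn.sub hf hg

lemma mul (hf : SlitSmooth U f) (hg : SlitSmooth U g) : SlitSmooth U fun x y => f x y * g x y :=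
  ContDiffOn.mul hf hg

lemma pow (hf : SlitSmooth U f) (m : ℕ) : SlitSmooth U fun x y => f x y ^ m :=
  ContDiffOn.pow hf m

lemma inv (hf : SlitSmooth U f) (h : ∀ x ∈ U, ∀ y : Pt n, y ≠ 0 → f x y ≠ 0) :
    SlitSmooth U fun x y => (f x y)⁻¹ :=
  ContDiffOn.inv hf fun p hp => h p.1 hp.1 p.2 hp.2

lemma div (hf : SlitSmooth U f) (hg : SlitSmooth U g)
    (h : ∀ x ∈ U, ∀ y : Pt n, y ≠ 0 → g x y ≠ 0) : SlitSmooth U fun x y => f x y / g x y :=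
  ContDiffOn.div hf hg fun p hp => h p.1 hp.1 p.2 hp.2

lemma sum {ι : Type*} {s : Finset ι} {f : ι → Pt n → Pt n → ℝ} (h : ∀ i, SlitSmooth U (f i)) :
    SlitSmooth U fun x y => ∑ i ∈ s, f i x y :=
  ContDiffOn.sum fun i _ => h i

lemma prod {ι : Type*} {s : Finset ι} {f : ι → Pt n → Pt n → ℝ} (h : ∀ i, SlitSmooth U (f i)) :
    SlitSmooth U fun x y => ∏ i ∈ s, f i x y :=
  contDiffOn_prod fun i _ => h i

lemma det {A : Pt n → Pt n → Matrix (Fin n) (Fin n) ℝ}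
    (h : ∀ i j, SlitSmooth U fun x y => A x y i j) : SlitSmooth U fun x y => (A x y).det := by
  simp only [Matrix.det_apply']
  exact sum fun σ => (const _).mul (prod fun i => h _ _)

lemma matrix_inv {A : Pt n → Pt n → Matrix (Fin n) (Fin n) ℝ}
    (h : ∀ i j, SlitSmooth U fun x y => A x y i j)
    (h0 : ∀ x ∈ U, ∀ y : Pt n, y ≠ 0 → (A x y).det ≠ 0) (i j : Fin n) :
    SlitSmooth U fun x y => (A x y)⁻¹ i j := by
  simp only [Matrix.inv_def, Ring.inverse_eq_inv', Matrix.smul_apply, smul_eq_mul,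
    Matrix.adjugate_apply]
  refine ((det h).inv h0).mul (det fun a b => ?_)
  by_cases hab : a = j
  · simpa [Matrix.updateRow_apply, hab] using const _
  · simpa [Matrix.updateRow_apply, hab] using h a b

end SlitSmooth

/-- Partial derivatives in the fiber commute. -/
lemma pdy_comm (hU : IsOpen U) (hf : SlitSmooth U f) (hx : x ∈ U) (hy : y ≠ 0) (i j : Fin n) :
    pdy (pdy f i) j x y = pdy (pdy f j) i x y := by
  have hc := hf.contDiffAt_right hU hx hy
  have hs : IsSymmSndFDerivAt ℝ (fun y' => f x y') y := hc.isSymmSndFDerivAt (by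
    simpa using WithTop.coe_le_coe.2 (le_top : (2 : ℕ∞) ≤ ⊤))
  have hd : DifferentiableAt ℝ (fderiv ℝ fun y' => f x y') y :=
    (hc.fderiv_right (m := ∞) (by simp)).differentiableAt (by simp)
  have key (a b : Fin n) : pdy (pdy f a) b x y
      = fderiv ℝ (fderiv ℝ fun y' => f x y') y (Pi.single b 1) (Pi.single a 1) := by
    have h := hd.hasFDerivAt.clm_apply (hasFDerivAt_const (Pi.single a (1 : ℝ) : Pt n) y)
    have h' := congrArg (fun L => L (Pi.single b 1)) h.fderiv
    simpa [pdy] using h'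
  rw [key, key, hs.eq]

/-- Euler's theorem on homogeneous functions. -/
lemma SlitHomog.euler (hU : IsOpen U) (hf : SlitSmooth U f) (h : SlitHomog U d f) (hx : x ∈ U)
    (hy : y ≠ 0) : ∑ r, pdy f r x y * y r = d * f x y := by
  have h1 : HasDerivAt (fun t : ℝ => t • y) y 1 := by
    simpa using (hasDerivAt_id (1 : ℝ)).smul_const y
  have hd : HasFDerivAt (fun y' => f x y') (fderiv ℝ (fun y' => f x y') y) ((1 : ℝ) • y) := by
    simpa using (hf.differentiableAt_right hU hx hy).hasFDerivAt
  have h2 := hd.comp_hasDerivAt (1 : ℝ) h1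
  have h3 : HasDerivAt (fun t : ℝ => t ^ d * f x y) (d * f x y) 1 := by
    simpa using (hasDerivAt_pow d (1 : ℝ)).mul_const (f x y)
  have h4 : ((fun y' => f x y') ∘ fun t : ℝ => t • y) =ᶠ[nhds 1] fun t => t ^ d * f x y := by
    filter_upwards [lt_mem_nhds one_pos] with t ht using h x hx y hy t ht
  rw [← h2.unique (h3.congr_of_eventuallyEq h4)]
  have h5 := congrArg (fderiv ℝ (fun y' => f x y') y) (pi_eq_sum_univ' y)
  simp only [map_sum, map_smul, smul_eq_mul] at h5
  rw [h5]
  exact Finset.sum_congr rfl fun r _ => mul_comm _ _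

namespace SlitHomog

lemma pdy (h : SlitHomog U (d + 1) f) (i : Fin n) : SlitHomog U d (pdy f i) := by
  intro x hx y hy t ht
  have h1 : (fun y' => f x (t • y')) =ᶠ[nhds y] fun y' => t ^ (d + 1) • f x y' := by
    filter_upwards [isOpen_ne.mem_nhds hy] with z hz using h x hx z hz t ht
  have h2 := h1.fderiv_eq (𝕜 := ℝ)
  rw [fderiv_comp_smul (f := fun y' => f x y'), fderiv_fun_const_smul_field] at h2
  have h3 := congrArg (fun L => L (Pi.single i 1)) h2
  simp only [smul_apply, smul_eq_mul] at h3
  refine mul_left_cancel₀ ht.ne' ?_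
  rw [_root_.pdy, h3, _root_.pdy]
  ring

lemma pdx (hU : IsOpen U) (h : SlitHomog U d f) (i : Fin n) : SlitHomog U d (pdx f i) := by
  intro x hx y hy t ht
  have h1 : (fun x' => f x' (t • y)) =ᶠ[nhds x] fun x' => t ^ d • f x' y := by
    filter_upwards [hU.mem_nhds hx] with z hz using h z hz y hy t ht
  have h2 := h1.fderiv_eq (𝕜 := ℝ)
  rw [fderiv_fun_const_smul_field] at h2
  simpa [_root_.pdx] using congrArg (fun L => L (Pi.single i 1)) h2

end SlitHomog

end Slit

namespace IsFinslerMetric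

variable {n : ℕ} {U : Set (Pt n)} {F : Pt n → Pt n → ℝ} {x y : Pt n}

lemma smooth_F2 (hF : IsFinslerMetric U F) : SlitSmooth U (F2 F) :=
  SlitSmooth.pow hF.smooth 2

lemma homog_F2 (hF : IsFinslerMetric U F) : SlitHomog U 2 (F2 F) := by
  intro x hx y hy t ht
  simp only [F2, hF.homog x hx y hy t ht, mul_pow]

lemma ne_zero (hF : IsFinslerMetric U F) : ∀ x ∈ U, ∀ y : Pt n, y ≠ 0 → F x y ≠ 0 :=
  fun x hx y hy => (hF.pos x hx y hy).ne'

lemma smooth_gLow (hF : IsFinslerMetric U F) (i j : Fin n) : SlitSmooth U (gLow F i j) :=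
  (SlitSmooth.const _).mul ((hF.smooth_F2.pdy hF.isOpen j).pdy hF.isOpen i)

lemma homog_gLow (hF : IsFinslerMetric U F) (i j : Fin n) : SlitHomog U 0 (gLow F i j) := by
  intro x hx y hy t ht
  simp [gLow, (hF.homog_F2.pdy j).pdy i x hx y hy t ht]

lemma gLow_symm (hF : IsFinslerMetric U F) (hx : x ∈ U) (hy : y ≠ 0) (i j : Fin n) :
    gLow F i j x y = gLow F j i x y := by
  simp only [gLow, pdy_comm hF.isOpen hF.smooth_F2 hx hy]

lemma smooth_gInv (hF : IsFinslerMetric U F) (i j : Fin n) : SlitSmooth U (gInv F i j) :=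
  SlitSmooth.matrix_inv (fun a b => hF.smooth_gLow a b)
    (fun x hx y hy => (hF.posdef x hx y hy).det_pos.ne') i j

lemma homog_gInv (hF : IsFinslerMetric U F) (i j : Fin n) : SlitHomog U 0 (gInv F i j) := by
  intro x hx y hy t ht
  have : gMat F x (t • y) = gMat F x y := by
    ext a b
    simpa [gMat] using hF.homog_gLow a b x hx y hy t ht
  simp [gInv, this]

lemma smooth_Gspray (hF : IsFinslerMetric U F) (i : Fin n) : SlitSmooth U (Gspray F i) := by
  have hU := hF.isOpen
  exact (SlitSmooth.const _).mul <| SlitSmooth.sum fun l => (hF.smooth_gInv i l).mul <|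
    (SlitSmooth.sum fun k => (SlitSmooth.coord k).mul ((hF.smooth_F2.pdy hU l).pdx hU k)).sub
      (hF.smooth_F2.pdx hU l)

lemma homog_Gspray (hF : IsFinslerMetric U F) (i : Fin n) : SlitHomog U 2 (Gspray F i) := by
  intro x hx y hy t ht
  have h1 (l : Fin n) := hF.homog_gInv i l x hx y hy t ht
  have h2 (l k : Fin n) := (hF.homog_F2.pdy l).pdx hF.isOpen k x hx y hy t ht
  have h3 (l : Fin n) := hF.homog_F2.pdx hF.isOpen l x hx y hy t ht
  simp only [Gspray, h1, h2, h3, Finset.mul_sum, Pi.smul_apply, smul_eq_mul, mul_sub]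
  refine Finset.sum_congr rfl fun l _ => ?_
  congr 1
  · exact Finset.sum_congr rfl fun k _ => by ring
  · ring

lemma sum_Γcon_mul (hF : IsFinslerMetric U F) (hx : x ∈ U) (hy : y ≠ 0) (i m : Fin n) :
    ∑ r, Γcon F i r m x y * y r = Ncon F i m x y := by
  simpa [Γcon, Ncon] using ((hF.homog_Gspray i).pdy m).euler hF.isOpen
    ((hF.smooth_Gspray i).pdy hF.isOpen m) hx hy

lemma yLow_eq (hF : IsFinslerMetric U F) (hx : x ∈ U) (hy : y ≠ 0) (i : Fin n) :
    yLow F i x y = 1 / 2 * pdy (F2 F) i x y := by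
  have h := (hF.homog_F2.pdy i).euler hF.isOpen (hF.smooth_F2.pdy hF.isOpen i) hx hy
  simp only [yLow, hF.gLow_symm hx hy i]
  simp only [gLow, mul_assoc, ← Finset.mul_sum, h]
  simp

lemma sum_yLow_mul (hF : IsFinslerMetric U F) (hx : x ∈ U) (hy : y ≠ 0) :
    ∑ i, yLow F i x y * y i = F x y ^ 2 := by
  have h := hF.homog_F2.euler hF.isOpen hF.smooth_F2 hx hy
  simp only [hF.yLow_eq hx hy, mul_assoc, ← Finset.mul_sum, h]
  simp [F2]

lemma sum_hUp_mul (hF : IsFinslerMetric U F) (hx : x ∈ U) (hy : y ≠ 0) (i : Fin n) :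
    ∑ a, hUp F i a x y * y a = 0 := by
  have h : ∑ a, y i * yLow F a x y / F x y ^ 2 * y a = y i / F x y ^ 2 * F x y ^ 2 := by
    rw [← hF.sum_yLow_mul hx hy, Finset.mul_sum]
    exact Finset.sum_congr rfl fun a _ => by ring
  have h0 := hF.ne_zero x hx y hy
  simp only [hUp, sub_mul, Finset.sum_sub_distrib, h]
  simp [h0]

lemma hLow_symm (hF : IsFinslerMetric U F) (hx : x ∈ U) (hy : y ≠ 0) (i j : Fin n) :
    hLow F i j x y = hLow F j i x y := by
  rw [hLow, hLow, hF.gLow_symm hx hy, mul_comm]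

lemma sum_hLow_mul (hF : IsFinslerMetric U F) (hx : x ∈ U) (hy : y ≠ 0) (i : Fin n) :
    ∑ a, hLow F i a x y * y a = 0 := by
  have h : ∑ a, yLow F i x y * yLow F a x y / F x y ^ 2 * y a
      = yLow F i x y / F x y ^ 2 * F x y ^ 2 := by
    rw [← hF.sum_yLow_mul hx hy, Finset.mul_sum]
    exact Finset.sum_congr rfl fun a _ => by ring
  have h0 := hF.ne_zero x hx y hy
  simp only [hLow, sub_mul, Finset.sum_sub_distrib, h]
  rw [← yLow]
  field_simp
  simp

lemma sum_hUp_mul_hLow (hF : IsFinslerMetric U F) (hx : x ∈ U) (hy : y ≠ 0) (j k : Fin n) :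
    ∑ m, hUp F m j x y * hLow F k m x y = hLow F k j x y := by
  have h : ∑ m, y m * yLow F j x y / F x y ^ 2 * hLow F k m x y
      = yLow F j x y / F x y ^ 2 * ∑ m, hLow F k m x y * y m := by
    rw [Finset.mul_sum]
    exact Finset.sum_congr rfl fun a _ => by ring
  simp [hUp, sub_mul, Finset.sum_sub_distrib, h, hF.sum_hLow_mul hx hy]

lemma trace_hUp (hF : IsFinslerMetric U F) (hx : x ∈ U) (hy : y ≠ 0) :
    ∑ m, hUp F m m x y = n - 1 := by
  have h : ∑ m, y m * yLow F m x y / F x y ^ 2 = F x y ^ 2 / F x y ^ 2 := by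
    rw [← Finset.sum_div, ← hF.sum_yLow_mul hx hy]
    simp only [mul_comm]
  have h0 := hF.ne_zero x hx y hy
  simp [hUp, Finset.sum_sub_distrib, h, h0]

lemma sum_Cartan_mul (hF : IsFinslerMetric U F) (hx : x ∈ U) (hy : y ≠ 0) (i j : Fin n) :
    ∑ k, Cartan F i j k x y * y k = 0 := by
  have hU := hF.isOpen
  have hswap (k : Fin n) : Cartan F i j k x y
      = 1 / 4 * pdy (pdy (pdy (F2 F) j) i) k x y := by
    rw [Cartan, pdy_congr (fun y hy => pdy_comm hU hF.smooth_F2 hx hy k j) hy,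
      pdy_comm hU (hF.smooth_F2.pdy hU j) hx hy]
  have h := ((hF.homog_F2.pdy j).pdy i).euler hU ((hF.smooth_F2.pdy hU j).pdy hU i) hx hy
  simp only [hswap, mul_assoc, ← Finset.mul_sum, h]
  simp

lemma smooth_yLow (hF : IsFinslerMetric U F) (i : Fin n) : SlitSmooth U (yLow F i) :=
  SlitSmooth.sum fun j => (hF.smooth_gLow i j).mul (SlitSmooth.coord j)

lemma smooth_hLow (hF : IsFinslerMetric U F) (i j : Fin n) : SlitSmooth U (hLow F i j) :=
  (hF.smooth_gLow i j).sub <| ((hF.smooth_yLow i).mul (hF.smooth_yLow j)).div hF.smooth_F2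
    fun x hx y hy => pow_ne_zero 2 (hF.ne_zero x hx y hy)

lemma smooth_Cartan (hF : IsFinslerMetric U F) (i j k : Fin n) : SlitSmooth U (Cartan F i j k) :=
  (SlitSmooth.const _).mul
    (((hF.smooth_F2.pdy hF.isOpen k).pdy hF.isOpen j).pdy hF.isOpen i)

lemma smooth_Ecurv (hF : IsFinslerMetric U F) (j k : Fin n) : SlitSmooth U (Ecurv F j k) :=
  (SlitSmooth.const _).mul <| SlitSmooth.sum fun m =>
    (((hF.smooth_Gspray m).pdy hF.isOpen m).pdy hF.isOpen k).pdy hF.isOpen j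

/-- If a smooth tensor is of the form `T_{jkl} yⁱ`, its horizontal derivative is proportional to
`yⁱ` too, since `yⁱ_{|m} = 0`. -/
lemma exists_hD13_eq_mul (hF : IsFinslerMetric U F)
    {D : Fin n → Fin n → Fin n → Fin n → Pt n → Pt n → ℝ}
    {T : Fin n → Fin n → Fin n → Pt n → Pt n → ℝ} (hT : ∀ j k l, SlitSmooth U (T j k l))
    (hD : ∀ x ∈ U, ∀ y : Pt n, y ≠ 0 → ∀ i j k l, D i j k l x y = T j k l x y * y i)
    (hx : x ∈ U) (hy : y ≠ 0) (i j k l m : Fin n) :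
    hD13 F D i j k l m x y = hD3 F T j k l m x y * y i := by
  have h1 : pdx (D i j k l) m x y = pdx (T j k l) m x y * y i := by
    rw [pdx_congr (g := fun x y => y i • T j k l x y) hF.isOpen hx
      fun x hx => by rw [hD x hx y hy, smul_eq_mul, mul_comm]]
    rw [pdx, fderiv_fun_const_smul_field, mul_comm]
    rfl
  have h2 (r : Fin n) : pdy (D i j k l) r x y
      = pdy (T j k l) r x y * y i + T j k l x y * if i = r then 1 else 0 := by
    rw [pdy_congr (g := fun x y => T j k l x y * y i) (fun y hy => hD x hx y hy i j k l) hy]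
    have h := ((hT j k l).differentiableAt_right hF.isOpen hx hy).hasFDerivAt.fun_mul
      (hasFDerivAt_apply (𝕜 := ℝ) i y)
    have h' := congrArg (fun L => L (Pi.single r 1)) h.fderiv
    simpa [pdy, Pi.single_apply, add_comm, mul_comm] using h'
  have h3 : ∑ r, T j k l x y * y r * Γcon F i r m x y = T j k l x y * Ncon F i m x y := by
    rw [← hF.sum_Γcon_mul hx hy, Finset.mul_sum]
    exact Finset.sum_congr rfl fun r _ => by ring
  have h4 : ∑ r, Ncon F r m x y * (pdy (T j k l) r x y * y i + T j k l x y *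
      if i = r then 1 else 0)
      = (∑ r, Ncon F r m x y * pdy (T j k l) r x y) * y i + T j k l x y * Ncon F i m x y := by
    simp [mul_add, Finset.sum_add_distrib, Finset.sum_mul, mul_assoc, mul_comm (T j k l x y)]
  simp only [hD13, hD3, hD0, h1, h2, hD x hx y hy, h3, h4]
  simp only [sub_mul, Finset.sum_mul, mul_right_comm _ (y i)]
  ring

end IsFinslerMetric

namespace IsGIB

variable {n : ℕ} {U : Set (Pt n)} {F μ lam : Pt n → Pt n → ℝ} {x y : Pt n}

lemma Ecurv_eq (hF : IsGIB U F μ lam) (hx : x ∈ U) (hy : y ≠ 0) (j k : Fin n) :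
    Ecurv F j k x y = (n + 1) / 2 * (lam x y * hLow F j k x y) := by
  have hM := hF.finsler
  have h1 : ∑ m, μ x y * Cartan F j k m x y * ell F m x y
      = μ x y / F x y * ∑ m, Cartan F j k m x y * y m := by
    rw [Finset.mul_sum]
    exact Finset.sum_congr rfl fun m _ => by rw [ell]; ring
  simp only [Ecurv, hF.berwald x hx y hy, Finset.sum_add_distrib, ← Finset.mul_sum, h1,
    ← Finset.sum_mul, hM.sum_Cartan_mul hx hy, hM.sum_hUp_mul_hLow hx hy, hM.trace_hUp hx hy,
    hM.hLow_symm hx hy k j]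
  ring

/-- The coefficient `T_{jkl}` in `Dⁱ_{jkl} = T_{jkl} yⁱ`. -/
noncomputable def douglasCoeff {n : ℕ} (F μ lam : Pt n → Pt n → ℝ) (j k l : Fin n) : Pt n → Pt n → ℝ :=
  fun x y => μ x y * Cartan F j k l x y / F x y
    - lam x y * (yLow F j x y * hLow F k l x y + yLow F k x y * hLow F j l x y
      + yLow F l x y * hLow F j k x y) / F x y ^ 2
    - 2 / ((n : ℝ) + 1) * pdy (Ecurv F j k) l x y

lemma smooth_douglasCoeff (hF : IsGIB U F μ lam) (j k l : Fin n) :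
    SlitSmooth U (douglasCoeff F μ lam j k l) := by
  have hM := hF.finsler
  have hμ : SlitSmooth U μ := hF.smooth_mu
  have hlam : SlitSmooth U lam := hF.smooth_lam
  have hy := hM.smooth_yLow
  have hh := hM.smooth_hLow
  exact (((hμ.mul (hM.smooth_Cartan j k l)).div hM.smooth hM.ne_zero).sub
    ((hlam.mul ((((hy j).mul (hh k l)).add ((hy k).mul (hh j l))).add
      ((hy l).mul (hh j k)))).div hM.smooth_F2
        fun x hx y hy => pow_ne_zero 2 (hM.ne_zero x hx y hy))).sub
    ((SlitSmooth.const _).mul ((hM.smooth_Ecurv j k).pdy hM.isOpen l))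

lemma Douglas_eq (hF : IsGIB U F μ lam) (hx : x ∈ U) (hy : y ≠ 0) (i j k l : Fin n) :
    Douglas F i j k l x y = douglasCoeff F μ lam j k l x y * y i := by
  have h0 := hF.finsler.ne_zero x hx y hy
  have hn : (n : ℝ) + 1 ≠ 0 := by positivity
  simp only [Douglas, douglasCoeff, hF.Ecurv_eq hx hy, hF.berwald x hx y hy, ell, hUp]
  field_simp
  ring

end IsGIB

/-- **Theorem 1.** Every generalized isotropic Berwald metric is a generalized
Douglas–Weyl metric: `hⁱ_α (Dᵅ_{jkl|m} yᵐ) = 0`. -/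
theorem gib_is_GDW {n : ℕ} (U : Set (Pt n)) (F μ lam : Pt n → Pt n → ℝ)
    (hF : IsGIB U F μ lam) :
    ∀ x ∈ U, ∀ y : Pt n, y ≠ 0 → ∀ i j k l : Fin n,
      ∑ α, hUp F i α x y * (∑ m, hD13 F (Douglas F) α j k l m x y * y m) = 0 := by
  intro x hx y hy i j k l
  have hM := hF.finsler
  have h := congrArg (fun c => c * ∑ m, hD3 F (IsGIB.douglasCoeff F μ lam) j k l m x y * y m)
    (hM.sum_hUp_mul hx hy i)
  simp only [zero_mul, Finset.sum_mul] at h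
  rw [← h]
  refine Finset.sum_congr rfl fun α _ => ?_
  rw [mul_assoc, Finset.mul_sum (a := y α)]
  congr 1
  refine Finset.sum_congr rfl fun m _ => ?_
  rw [hM.exists_hD13_eq_mul hF.smooth_douglasCoeff (fun x hx y hy => hF.Douglas_eq hx hy) hx hy]
  ring
end

section
/- If F is a generalized isotropic Berwald metric with data (μ, λ), then its Landsberg curvature satisfies L_{jkl} = −(1/2) μ F C_{jkl} at every point of U × (ℝ^n ∖ {0}); equivalently, μ C_{jkl} = −2 F^{−1} L_{jkl}. -/
noncomputable section FinslerCalculus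

variable {n : ℕ}

/-- Equality of two functions of `(x, y)` on the slit bundle over `U`. -/
def EqSlit (U : Set (Pt n)) (S T : Pt n → Pt n → ℝ) : Prop :=
  ∀ x ∈ U, ∀ y : Pt n, y ≠ 0 → S x y = T x y

/-- Smoothness on the slit bundle over `U`. -/
def SmoothSlit (U : Set (Pt n)) (T : Pt n → Pt n → ℝ) : Prop :=
  ∀ x ∈ U, ∀ y : Pt n, y ≠ 0 → ContDiffAt ℝ (⊤ : ℕ∞) (Function.uncurry T) (x, y)

/-- The operator `T ↦ Aⁱ ∂T/∂yⁱ`. -/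
def vertOp (A : Fin n → Pt n → Pt n → ℝ) (T : Pt n → Pt n → ℝ) : Pt n → Pt n → ℝ :=
  fun x y => ∑ i, A i x y * pdy T i x y

/-- The operator `T ↦ yᵏ ∂T/∂xᵏ`. -/
def baseOp (T : Pt n → Pt n → ℝ) : Pt n → Pt n → ℝ :=
  fun x y => ∑ k, y k * pdx T k x y

variable {U : Set (Pt n)} {S T : Pt n → Pt n → ℝ}

theorem eventually_slit (hU : IsOpen U) {x y : Pt n} (hx : x ∈ U) (hy : y ≠ 0) :
    ∀ᶠ p : Pt n × Pt n in nhds (x, y), p.1 ∈ U ∧ p.2 ≠ 0 :=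
  (hU.prod isOpen_ne).mem_nhds ⟨hx, hy⟩

theorem EqSlit.pdy (h : EqSlit U S T) (i : Fin n) : EqSlit U (pdy S i) (pdy T i) := by
  intro x hx y hy
  have : (fun y' => S x y') =ᶠ[nhds y] fun y' => T x y' := by
    filter_upwards [isOpen_ne.mem_nhds hy] with y' hy' using h x hx y' hy'
  simp only [_root_.pdy, this.fderiv_eq]

theorem SmoothSlit.differentiableAt (h : SmoothSlit U T) {x y : Pt n} (hx : x ∈ U) (hy : y ≠ 0) :
    DifferentiableAt ℝ (Function.uncurry T) (x, y) :=
  (h x hx y hy).differentiableAt (by simp)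

theorem SmoothSlit.differentiableAt_snd (h : SmoothSlit U T) {x y : Pt n} (hx : x ∈ U)
    (hy : y ≠ 0) : DifferentiableAt ℝ (fun y' => T x y') y :=
  (h.differentiableAt hx hy).comp (f := fun y' : Pt n => (x, y')) y (by fun_prop)

theorem SmoothSlit.pdy_eq (h : SmoothSlit U T) (i : Fin n) {x y : Pt n} (hx : x ∈ U)
    (hy : y ≠ 0) :
    pdy T i x y = fderiv ℝ (Function.uncurry T) (x, y) (0, Pi.single i 1) := by
  have h1 := (h.differentiableAt hx hy).hasFDerivAt.comp (f := fun y' : Pt n => (x, y')) y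
    (hasFDerivAt_prodMk_right x y)
  have h2 : fderiv ℝ (fun y' => T x y') y = _ := h1.fderiv
  simp [pdy, h2]

theorem SmoothSlit.pdx_eq (h : SmoothSlit U T) (i : Fin n) {x y : Pt n} (hx : x ∈ U)
    (hy : y ≠ 0) :
    pdx T i x y = fderiv ℝ (Function.uncurry T) (x, y) (Pi.single i 1, 0) := by
  have h1 := (h.differentiableAt hx hy).hasFDerivAt.comp (f := fun x' : Pt n => (x', y)) x
    (hasFDerivAt_prodMk_left x y)
  have h2 : fderiv ℝ (fun x' => T x' y) x = _ := h1.fderiv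
  simp [pdx, h2]

theorem SmoothSlit.eventually_pdy_eq (hU : IsOpen U) (h : SmoothSlit U T) (i : Fin n) {x y : Pt n}
    (hx : x ∈ U) (hy : y ≠ 0) :
    Function.uncurry (_root_.pdy T i) =ᶠ[nhds (x, y)]
      fun p => fderiv ℝ (Function.uncurry T) p (0, Pi.single i 1) := by
  filter_upwards [eventually_slit hU hx hy] with p hp
  exact h.pdy_eq i hp.1 hp.2

theorem SmoothSlit.eventually_pdx_eq (hU : IsOpen U) (h : SmoothSlit U T) (i : Fin n) {x y : Pt n}
    (hx : x ∈ U) (hy : y ≠ 0) :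
    Function.uncurry (_root_.pdx T i) =ᶠ[nhds (x, y)]
      fun p => fderiv ℝ (Function.uncurry T) p (Pi.single i 1, 0) := by
  filter_upwards [eventually_slit hU hx hy] with p hp
  exact h.pdx_eq i hp.1 hp.2

theorem contDiffAt_fderiv_apply_const {E : Type*} [NormedAddCommGroup E] [NormedSpace ℝ E]
    {g : E → ℝ} {p : E} (hg : ContDiffAt ℝ (⊤ : ℕ∞) g p) (v : E) :
    ContDiffAt ℝ (⊤ : ℕ∞) (fun q => fderiv ℝ g q v) p :=
  (hg.fderiv_right (m := (⊤ : ℕ∞)) (by simp)).clm_apply contDiffAt_const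

theorem fderiv_fderiv_apply_comm {E : Type*} [NormedAddCommGroup E] [NormedSpace ℝ E]
    {g : E → ℝ} {p : E} (hg : ContDiffAt ℝ (⊤ : ℕ∞) g p) (v w : E) :
    fderiv ℝ (fun q => fderiv ℝ g q v) p w = fderiv ℝ (fun q => fderiv ℝ g q w) p v := by
  have hd : DifferentiableAt ℝ (fderiv ℝ g) p :=
    (hg.fderiv_right (m := (⊤ : ℕ∞)) (by simp)).differentiableAt (by simp)
  have hs : IsSymmSndFDerivAt ℝ g p := hg.isSymmSndFDerivAt (by simpa using WithTop.coe_le_coe.2 (le_top : (2 : ℕ∞) ≤ ⊤))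
  rw [fderiv_clm_apply hd (differentiableAt_const _), fderiv_clm_apply hd (differentiableAt_const _)]
  simpa using hs w v

theorem SmoothSlit.pdy (hU : IsOpen U) (h : SmoothSlit U T) (i : Fin n) :
    SmoothSlit U (pdy T i) := fun x hx y hy =>
  (contDiffAt_fderiv_apply_const (h x hx y hy) _).congr_of_eventuallyEq
    (h.eventually_pdy_eq hU i hx hy)

theorem SmoothSlit.pdx (hU : IsOpen U) (h : SmoothSlit U T) (i : Fin n) :
    SmoothSlit U (pdx T i) := fun x hx y hy =>
  (contDiffAt_fderiv_apply_const (h x hx y hy) _).congr_of_eventuallyEq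
    (h.eventually_pdx_eq hU i hx hy)

theorem SmoothSlit.pdy_pdy_comm (hU : IsOpen U) (h : SmoothSlit U T) (i j : Fin n) :
    EqSlit U (_root_.pdy (_root_.pdy T i) j) (_root_.pdy (_root_.pdy T j) i) := by
  intro x hx y hy
  rw [(h.pdy hU i).pdy_eq j hx hy, (h.pdy hU j).pdy_eq i hx hy,
    (h.eventually_pdy_eq hU i hx hy).fderiv_eq, (h.eventually_pdy_eq hU j hx hy).fderiv_eq]
  exact fderiv_fderiv_apply_comm (h x hx y hy) _ _

theorem SmoothSlit.pdy_pdx_comm (hU : IsOpen U) (h : SmoothSlit U T) (i j : Fin n) :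
    EqSlit U (_root_.pdy (_root_.pdx T i) j) (_root_.pdx (_root_.pdy T j) i) := by
  intro x hx y hy
  rw [(h.pdx hU i).pdy_eq j hx hy, (h.pdy hU j).pdx_eq i hx hy,
    (h.eventually_pdx_eq hU i hx hy).fderiv_eq, (h.eventually_pdy_eq hU j hx hy).fderiv_eq]
  exact fderiv_fderiv_apply_comm (h x hx y hy) _ _

theorem smoothSlit_const (c : ℝ) : SmoothSlit U fun _ _ => c :=
  fun _ _ _ _ => contDiffAt_const

theorem smoothSlit_coord (k : Fin n) : SmoothSlit U fun _ y => y k := by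
  intro x _ y _
  have : ContDiff ℝ (⊤ : ℕ∞) fun p : Pt n × Pt n => p.2 k := by fun_prop
  exact this.contDiffAt

theorem SmoothSlit.add (hS : SmoothSlit U S) (hT : SmoothSlit U T) :
    SmoothSlit U fun x y => S x y + T x y :=
  fun x hx y hy => (hS x hx y hy).add (hT x hx y hy)

theorem SmoothSlit.sub (hS : SmoothSlit U S) (hT : SmoothSlit U T) :
    SmoothSlit U fun x y => S x y - T x y :=
  fun x hx y hy => (hS x hx y hy).sub (hT x hx y hy)

theorem SmoothSlit.mul (hS : SmoothSlit U S) (hT : SmoothSlit U T) :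
    SmoothSlit U fun x y => S x y * T x y :=
  fun x hx y hy => (hS x hx y hy).mul (hT x hx y hy)

theorem SmoothSlit.inv (hT : SmoothSlit U T) (h0 : ∀ x ∈ U, ∀ y : Pt n, y ≠ 0 → T x y ≠ 0) :
    SmoothSlit U fun x y => (T x y)⁻¹ :=
  fun x hx y hy => (hT x hx y hy).inv (h0 x hx y hy)

theorem SmoothSlit.sum {ι : Type*} {s : Finset ι} {A : ι → Pt n → Pt n → ℝ}
    (hA : ∀ i, SmoothSlit U (A i)) : SmoothSlit U fun x y => ∑ i ∈ s, A i x y := by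
  intro x hx y hy
  exact ContDiffAt.sum (f := fun i (p : Pt n × Pt n) => A i p.1 p.2) fun i _ => hA i x hx y hy

theorem SmoothSlit.prod {ι : Type*} {s : Finset ι} {A : ι → Pt n → Pt n → ℝ}
    (hA : ∀ i, SmoothSlit U (A i)) : SmoothSlit U fun x y => ∏ i ∈ s, A i x y := by
  intro x hx y hy
  exact contDiffAt_prod (f := fun i (p : Pt n × Pt n) => A i p.1 p.2) fun i _ => hA i x hx y hy

theorem SmoothSlit.det {m : Type*} [Fintype m] [DecidableEq m]
    {A : m → m → Pt n → Pt n → ℝ} (hA : ∀ i j, SmoothSlit U (A i j)) :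
    SmoothSlit U fun x y => (Matrix.of fun i j => A i j x y).det := by
  simp only [Matrix.det_apply', Matrix.of_apply]
  exact SmoothSlit.sum fun σ => (smoothSlit_const _).mul (SmoothSlit.prod fun i => hA _ _)

theorem SmoothSlit.matrix_inv {m : Type*} [Fintype m] [DecidableEq m]
    {A : m → m → Pt n → Pt n → ℝ} (hA : ∀ i j, SmoothSlit U (A i j))
    (h0 : ∀ x ∈ U, ∀ y : Pt n, y ≠ 0 → (Matrix.of fun i j => A i j x y).det ≠ 0) (i j : m) :
    SmoothSlit U fun x y => (Matrix.of fun i j => A i j x y)⁻¹ i j := by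
  simp only [Matrix.inv_def, Ring.inverse_eq_inv', Matrix.smul_apply, smul_eq_mul,
    Matrix.adjugate_apply]
  refine ((SmoothSlit.det hA).inv h0).mul ?_
  have hB : ∀ a b, SmoothSlit U fun x y =>
      (Matrix.of fun i j => A i j x y).updateRow j (Pi.single i 1) a b := by
    intro a b
    by_cases h : a = j
    · subst h
      simpa using smoothSlit_const _
    · simpa [Matrix.updateRow_ne h] using hA a b
  exact SmoothSlit.det hB

theorem SmoothSlit.pdy_add (hS : SmoothSlit U S) (hT : SmoothSlit U T) (j : Fin n) :
    EqSlit U (_root_.pdy (fun x y => S x y + T x y) j)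
      fun x y => _root_.pdy S j x y + _root_.pdy T j x y := by
  intro x hx y hy
  simp only [_root_.pdy]
  rw [fderiv_fun_add (hS.differentiableAt_snd hx hy) (hT.differentiableAt_snd hx hy)]
  rfl

theorem SmoothSlit.pdy_const_mul (hT : SmoothSlit U T) (c : ℝ) (j : Fin n) :
    EqSlit U (_root_.pdy (fun x y => c * T x y) j) fun x y => c * _root_.pdy T j x y := by
  intro x hx y hy
  simp only [_root_.pdy]
  rw [fderiv_const_mul (hT.differentiableAt_snd hx hy)]
  rfl

theorem SmoothSlit.pdx_const_mul (hT : SmoothSlit U T) (c : ℝ) (j : Fin n) :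
    EqSlit U (_root_.pdx (fun x y => c * T x y) j) fun x y => c * _root_.pdx T j x y := by
  intro x hx y hy
  have hd : DifferentiableAt ℝ (fun x' => T x' y) x :=
    (hT.differentiableAt hx hy).comp (f := fun x' : Pt n => (x', y)) x (by fun_prop)
  simp only [_root_.pdx]
  rw [fderiv_const_mul hd]
  rfl

theorem pdy_sum_mul {A B : Fin n → Pt n → Pt n → ℝ} (hA : ∀ i, SmoothSlit U (A i))
    (hB : ∀ i, SmoothSlit U (B i)) (j : Fin n) :
    EqSlit U (pdy (fun x y => ∑ i, A i x y * B i x y) j)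
      fun x y => (∑ i, A i x y * pdy (B i) j x y) + ∑ i, pdy (A i) j x y * B i x y := by
  intro x hx y hy
  simp only [pdy]
  rw [fderiv_fun_sum fun i _ => ((hA i).differentiableAt_snd hx hy).fun_mul
    ((hB i).differentiableAt_snd hx hy), sum_apply, ← Finset.sum_add_distrib]
  refine Finset.sum_congr rfl fun i _ => ?_
  rw [fderiv_fun_mul ((hA i).differentiableAt_snd hx hy) ((hB i).differentiableAt_snd hx hy)]
  simp [mul_comm]

theorem pdy_coord (k j : Fin n) (x y : Pt n) :
    pdy (fun _ y' : Pt n => y' k) j x y = if k = j then 1 else 0 := by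
  have : fderiv ℝ (fun y' : Pt n => y' k) y = ContinuousLinearMap.proj k :=
    (ContinuousLinearMap.proj (R := ℝ) (φ := fun _ : Fin n => ℝ) k).fderiv
  simp [pdy, this, Pi.single_apply]

theorem SmoothSlit.vertOp (hU : IsOpen U) {A : Fin n → Pt n → Pt n → ℝ}
    (hA : ∀ i, SmoothSlit U (A i)) (hT : SmoothSlit U T) : SmoothSlit U (vertOp A T) :=
  SmoothSlit.sum fun i => (hA i).mul (hT.pdy hU i)

theorem SmoothSlit.baseOp (hU : IsOpen U) (hT : SmoothSlit U T) : SmoothSlit U (baseOp T) :=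
  SmoothSlit.sum fun k => (smoothSlit_coord k).mul (hT.pdx hU k)

theorem pdy_vertOp (hU : IsOpen U) {A : Fin n → Pt n → Pt n → ℝ}
    (hA : ∀ i, SmoothSlit U (A i)) (hT : SmoothSlit U T) (j : Fin n) :
    EqSlit U (pdy (vertOp A T) j)
      fun x y => vertOp A (pdy T j) x y + vertOp (fun i => pdy (A i) j) T x y := by
  intro x hx y hy
  refine (pdy_sum_mul hA (fun i => hT.pdy hU i) j x hx y hy).trans ?_
  simp only [vertOp]
  congr 1
  exact Finset.sum_congr rfl fun i _ => by rw [hT.pdy_pdy_comm hU i j x hx y hy]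

theorem pdy_baseOp (hU : IsOpen U) (hT : SmoothSlit U T) (j : Fin n) :
    EqSlit U (pdy (baseOp T) j) fun x y => baseOp (pdy T j) x y + pdx T j x y := by
  intro x hx y hy
  refine (pdy_sum_mul (A := fun k _ y => y k) smoothSlit_coord
    (fun i => hT.pdx hU i) j x hx y hy).trans ?_
  simp only [baseOp, pdy_coord, ite_mul, one_mul, zero_mul, Finset.sum_ite_eq',
    Finset.mem_univ, if_true]
  congr 1
  exact Finset.sum_congr rfl fun i _ => by rw [hT.pdy_pdx_comm hU i j x hx y hy]

/-- The derivative of Euler's relation of degree `d + 1`. -/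
theorem euler_pdy (hU : IsOpen U) (hT : SmoothSlit U T) {d : ℝ}
    (h : EqSlit U (vertOp (fun k _ y => y k) T) fun x y => (d + 1) * T x y) (j : Fin n) :
    EqSlit U (vertOp (fun k _ y => y k) (pdy T j)) fun x y => d * pdy T j x y := by
  intro x hx y hy
  have h1 := h.pdy j x hx y hy
  rw [hT.pdy_const_mul _ j x hx y hy, pdy_vertOp hU smoothSlit_coord hT j x hx y hy] at h1
  have h2 : vertOp (fun i => pdy (fun _ y : Pt n => y i) j) T x y = pdy T j x y := by
    simp [vertOp, pdy_coord]
  simp only [h2] at h1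
  linarith

end FinslerCalculus

section Finsler

variable {n : ℕ} {U : Set (Pt n)} {F : Pt n → Pt n → ℝ}

theorem IsFinslerMetric.smoothSlit_F2 (hF : IsFinslerMetric U F) : SmoothSlit U (F2 F) := by
  intro x hx y hy
  have : ContDiffAt ℝ (⊤ : ℕ∞) (Function.uncurry F) (x, y) :=
    hF.smooth.contDiffAt ((hF.isOpen.prod isOpen_ne).mem_nhds ⟨hx, hy⟩)
  exact this.pow 2

theorem IsFinslerMetric.euler_F2 (hF : IsFinslerMetric U F) :
    EqSlit U (vertOp (fun k _ y => y k) (F2 F)) fun x y => (1 + 1) * F2 F x y := by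
  intro x hx y hy
  have hd := (hF.smoothSlit_F2.differentiableAt_snd hx hy).hasFDerivAt
  have hl : HasDerivAt (fun t : ℝ => t • y) y 1 := by
    simpa using (hasDerivAt_id (1 : ℝ)).smul_const y
  have h1 : HasDerivAt (fun t : ℝ => F2 F x (t • y)) (fderiv ℝ (fun y' => F2 F x y') y y) 1 := by
    refine HasFDerivAt.comp_hasDerivAt (l := fun y' => F2 F x y') 1 ?_ hl
    simpa using hd
  have h2 : HasDerivAt (fun t : ℝ => t ^ 2 * F2 F x y) (2 * F2 F x y) 1 := by
    simpa using (hasDerivAt_pow 2 (1 : ℝ)).mul_const (F2 F x y)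
  have h3 : (fun t : ℝ => F2 F x (t • y)) =ᶠ[nhds 1] fun t => t ^ 2 * F2 F x y := by
    filter_upwards [lt_mem_nhds (zero_lt_one (α := ℝ))] with t ht
    simp only [F2, hF.homog x hx y hy t ht, mul_pow]
  have h4 := h1.unique (h2.congr_of_eventuallyEq h3)
  have h5 : vertOp (fun k _ y => y k) (F2 F) x y = fderiv ℝ (fun y' => F2 F x y') y y := by
    simp only [vertOp, pdy]
    generalize fderiv ℝ (fun y' => F2 F x y') y = L
    conv_rhs => rw [pi_eq_sum_univ' y, map_sum]
    simp only [map_smul, smul_eq_mul]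
  rw [h5, h4]
  norm_num

theorem IsFinslerMetric.gLow_comm (hF : IsFinslerMetric U F) (i j : Fin n) :
    EqSlit U (gLow F i j) (gLow F j i) := by
  intro x hx y hy
  simp only [gLow]
  rw [hF.smoothSlit_F2.pdy_pdy_comm hF.isOpen j i x hx y hy]

theorem IsFinslerMetric.det_ne_zero (hF : IsFinslerMetric U F) :
    ∀ x ∈ U, ∀ y : Pt n, y ≠ 0 → (gMat F x y).det ≠ 0 :=
  fun x hx y hy => (hF.posdef x hx y hy).det_pos.ne'

theorem IsFinslerMetric.smoothSlit_gLow (hF : IsFinslerMetric U F) (i j : Fin n) :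
    SmoothSlit U (gLow F i j) :=
  (smoothSlit_const _).mul ((hF.smoothSlit_F2.pdy hF.isOpen j).pdy hF.isOpen i)

theorem IsFinslerMetric.smoothSlit_Gspray (hF : IsFinslerMetric U F) (i : Fin n) :
    SmoothSlit U (Gspray F i) :=
  (smoothSlit_const _).mul <| SmoothSlit.sum fun l =>
    (SmoothSlit.matrix_inv hF.smoothSlit_gLow hF.det_ne_zero i l).mul <|
      ((hF.smoothSlit_F2.pdy hF.isOpen l).baseOp hF.isOpen).sub (hF.smoothSlit_F2.pdx hF.isOpen l)

theorem IsFinslerMetric.vertOp_pdy_F2 (hF : IsFinslerMetric U F) (A : Fin n → Pt n → Pt n → ℝ)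
    (l : Fin n) :
    EqSlit U (vertOp A (pdy (F2 F) l))
      fun x y => 2 * (gMat F x y).mulVec (fun i => A i x y) l := by
  intro x hx y hy
  simp only [vertOp, Matrix.mulVec, dotProduct, gMat, Matrix.of_apply, Finset.mul_sum]
  refine Finset.sum_congr rfl fun i _ => ?_
  rw [hF.gLow_comm l i x hx y hy, gLow]
  ring

/-- The defining equation of the spray, with its free index lowered. -/
theorem IsFinslerMetric.vertOp_Gspray_pdy (hF : IsFinslerMetric U F) (l : Fin n) :
    EqSlit U (fun x y => 2 * vertOp (Gspray F) (pdy (F2 F) l) x y)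
      fun x y => baseOp (pdy (F2 F) l) x y - pdx (F2 F) l x y := by
  intro x hx y hy
  have hG : (fun i => Gspray F i x y) = (1 / 4 : ℝ) • (gMat F x y)⁻¹.mulVec
      fun l => baseOp (pdy (F2 F) l) x y - pdx (F2 F) l x y := by
    ext i
    simp [Gspray, Matrix.mulVec, dotProduct, gInv, baseOp]
  simp only [hF.vertOp_pdy_F2 _ l x hx y hy, hG]
  rw [Matrix.mulVec_smul, Matrix.mulVec_mulVec,
    Matrix.mul_nonsing_inv _ (hF.det_ne_zero x hx y hy).isUnit, Matrix.one_mulVec]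
  simp only [Pi.smul_apply, smul_eq_mul]
  ring

theorem IsFinslerMetric.euler_pdy_F2 (hF : IsFinslerMetric U F) (l : Fin n) :
    EqSlit U (vertOp (fun k _ y => y k) (pdy (F2 F) l)) (pdy (F2 F) l) := by
  intro x hx y hy
  simpa using euler_pdy hF.isOpen hF.smoothSlit_F2 hF.euler_F2 l x hx y hy

theorem IsFinslerMetric.euler_pdy_pdy_F2 (hF : IsFinslerMetric U F) (l m : Fin n) :
    EqSlit U (vertOp (fun k _ y => y k) (pdy (pdy (F2 F) l) m)) fun _ _ => 0 := by
  intro x hx y hy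
  have h : EqSlit U (vertOp (fun k _ y => y k) (pdy (F2 F) l))
      fun x y => (0 + 1) * pdy (F2 F) l x y := by
    intro x hx y hy
    simpa using hF.euler_pdy_F2 l x hx y hy
  simpa using euler_pdy hF.isOpen (hF.smoothSlit_F2.pdy hF.isOpen l) h m x hx y hy

theorem sum_mul_pdx_vert (hU : IsOpen U) {T : Pt n → Pt n → ℝ} (hT : SmoothSlit U T) {d : ℝ}
    (h : EqSlit U (vertOp (fun k _ y => y k) T) fun x y => d * T x y) (m : Fin n) :
    EqSlit U (fun x y => ∑ k, y k * pdx (pdy T k) m x y) fun x y => d * pdx T m x y := by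
  intro x hx y hy
  have hc : (fun x' => ∑ k, y k * pdy T k x' y) =ᶠ[nhds x] fun x' => d * T x' y := by
    filter_upwards [hU.mem_nhds hx] with x' hx' using h x' hx' y hy
  have hdiff : ∀ {S : Pt n → Pt n → ℝ}, SmoothSlit U S →
      DifferentiableAt ℝ (fun x' => S x' y) x := fun hS =>
    (hS.differentiableAt hx hy).comp (f := fun x' : Pt n => (x', y)) x (by fun_prop)
  have h1 := congrArg (fun L : Pt n →L[ℝ] ℝ => L (Pi.single m (1 : ℝ))) hc.fderiv_eq
  rw [fderiv_const_mul (hdiff hT),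
    fderiv_fun_sum fun k _ => (hdiff (hT.pdy hU k)).const_mul (y k),
    sum_apply] at h1
  simp only [pdx]
  refine Eq.trans (Finset.sum_congr rfl fun k _ => ?_) h1
  rw [fderiv_const_mul (hdiff (hT.pdy hU k))]
  rfl

/-- `F` is horizontally constant along the spray. -/
theorem IsFinslerMetric.baseOp_F2 (hF : IsFinslerMetric U F) :
    EqSlit U (baseOp (F2 F)) fun x y => 2 * vertOp (Gspray F) (F2 F) x y := by
  intro x hx y hy
  have h1 : ∑ l, y l * (2 * vertOp (Gspray F) (pdy (F2 F) l) x y)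
      = ∑ l, y l * (baseOp (pdy (F2 F) l) x y - pdx (F2 F) l x y) :=
    Finset.sum_congr rfl fun l _ =>
      congrArg (y l * ·) (hF.vertOp_Gspray_pdy l x hx y hy)
  have h2 : ∑ l, y l * (2 * vertOp (Gspray F) (pdy (F2 F) l) x y)
      = 2 * vertOp (Gspray F) (F2 F) x y := by
    simp only [vertOp, Finset.mul_sum]
    rw [Finset.sum_comm]
    refine Finset.sum_congr rfl fun i _ => ?_
    rw [← hF.euler_pdy_F2 i x hx y hy]
    simp only [vertOp, Finset.mul_sum]
    refine Finset.sum_congr rfl fun l _ => ?_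
    rw [hF.smoothSlit_F2.pdy_pdy_comm hF.isOpen i l x hx y hy]
    ring
  have h3 : ∑ l, y l * baseOp (pdy (F2 F) l) x y = 2 * baseOp (F2 F) x y := by
    simp only [baseOp, Finset.mul_sum]
    rw [Finset.sum_comm]
    refine Finset.sum_congr rfl fun k _ => ?_
    have := sum_mul_pdx_vert hF.isOpen hF.smoothSlit_F2 hF.euler_F2 k x hx y hy
    calc _ = y k * ∑ l, y l * pdx (pdy (F2 F) l) k x y := by
            rw [Finset.mul_sum]
            exact Finset.sum_congr rfl fun l _ => by ring
      _ = _ := by simp only at this; rw [this]; ring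
  have h4 : ∑ l, y l * pdx (F2 F) l x y = baseOp (F2 F) x y := rfl
  simp only [mul_sub, Finset.sum_sub_distrib] at h1
  linarith

/-- `F` is horizontally constant. -/
theorem IsFinslerMetric.pdx_F2 (hF : IsFinslerMetric U F) (l : Fin n) :
    EqSlit U (pdx (F2 F) l) (vertOp (fun i => Ncon F i l) (F2 F)) := by
  intro x hx y hy
  have h1 := hF.baseOp_F2.pdy l x hx y hy
  rw [pdy_baseOp hF.isOpen hF.smoothSlit_F2 l x hx y hy,
    (SmoothSlit.vertOp hF.isOpen hF.smoothSlit_Gspray hF.smoothSlit_F2).pdy_const_mul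
      2 l x hx y hy] at h1
  simp only [pdy_vertOp hF.isOpen hF.smoothSlit_Gspray hF.smoothSlit_F2 l x hx y hy] at h1
  have h2 := hF.vertOp_Gspray_pdy l x hx y hy
  simp only at h2
  change _ = vertOp (fun i => pdy (Gspray F i) l) (F2 F) x y
  linarith

/-- The spray coefficients are homogeneous of degree two. -/
theorem IsFinslerMetric.euler_Gspray (hF : IsFinslerMetric U F) (i : Fin n) :
    EqSlit U (vertOp (fun k _ y => y k) (Gspray F i)) fun x y => (1 + 1) * Gspray F i x y := by
  have hU := hF.isOpen
  have hf := hF.smoothSlit_F2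
  intro x hx y hy
  set N : Fin n → Pt n → Pt n → ℝ := fun i => vertOp (fun k _ y => y k) (Gspray F i) with hN
  have key : ∀ l, vertOp N (pdy (F2 F) l) x y = 2 * vertOp (Gspray F) (pdy (F2 F) l) x y := by
    intro l
    have hfl := hf.pdy hU l
    have h1 : ∀ m, y m * (2 * (vertOp (Gspray F) (pdy (pdy (F2 F) l) m) x y
          + vertOp (fun i => pdy (Gspray F i) m) (pdy (F2 F) l) x y))
        = y m * (baseOp (pdy (pdy (F2 F) l) m) x y + pdx (pdy (F2 F) l) m x y
          - pdx (pdy (F2 F) m) l x y) := by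
      intro m
      have h := (hF.vertOp_Gspray_pdy l).pdy m x hx y hy
      have hsub := ((hfl.baseOp hU).pdy_add ((smoothSlit_const (-1)).mul (hf.pdx hU l))
        m x hx y hy)
      rw [(SmoothSlit.vertOp hU hF.smoothSlit_Gspray hfl).pdy_const_mul 2 m x hx y hy] at h
      simp only [(hf.pdx hU l).pdy_const_mul (-1) m x hx y hy,
        pdy_baseOp hU hfl m x hx y hy, hf.pdy_pdx_comm hU l m x hx y hy] at hsub
      simp only [pdy_vertOp hU hF.smoothSlit_Gspray hfl m x hx y hy] at h
      rw [h]
      congr 1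
      simp only [neg_mul, one_mul, ← sub_eq_add_neg] at hsub
      exact hsub
    have h2 : ∑ m, y m * vertOp (Gspray F) (pdy (pdy (F2 F) l) m) x y = 0 := by
      simp only [vertOp, Finset.mul_sum]
      rw [Finset.sum_comm]
      refine Finset.sum_eq_zero fun i _ => ?_
      have := hF.euler_pdy_pdy_F2 l i x hx y hy
      simp only [vertOp] at this
      calc _ = Gspray F i x y * ∑ m, y m * pdy (pdy (pdy (F2 F) l) i) m x y := by
              rw [Finset.mul_sum]
              refine Finset.sum_congr rfl fun m _ => ?_
              rw [hfl.pdy_pdy_comm hU m i x hx y hy]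
              ring
        _ = 0 := by rw [this, mul_zero]
    have h3 : ∑ m, y m * vertOp (fun i => pdy (Gspray F i) m) (pdy (F2 F) l) x y
        = vertOp N (pdy (F2 F) l) x y := by
      simp only [vertOp, Finset.mul_sum, hN, Finset.sum_mul]
      rw [Finset.sum_comm]
      exact Finset.sum_congr rfl fun i _ => Finset.sum_congr rfl fun m _ => by ring
    have h4 : ∑ m, y m * baseOp (pdy (pdy (F2 F) l) m) x y = baseOp (pdy (F2 F) l) x y := by
      simp only [baseOp, Finset.mul_sum]
      rw [Finset.sum_comm]
      refine Finset.sum_congr rfl fun k _ => ?_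
      have := sum_mul_pdx_vert hU hfl (d := 1)
        (by simpa [one_mul] using hF.euler_pdy_F2 l) k x hx y hy
      simp only [one_mul] at this
      rw [← this, Finset.mul_sum]
      exact Finset.sum_congr rfl fun m _ => by ring
    have h5 : ∑ m, y m * pdx (pdy (F2 F) l) m x y = baseOp (pdy (F2 F) l) x y := rfl
    have h6 : ∑ m, y m * pdx (pdy (F2 F) m) l x y = 2 * pdx (F2 F) l x y := by
      have := sum_mul_pdx_vert hU hf hF.euler_F2 l x hx y hy
      simp only at this
      rw [this]
      ring
    have h7 : 2 * (∑ m, y m * vertOp (Gspray F) (pdy (pdy (F2 F) l) m) x y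
          + ∑ m, y m * vertOp (fun i => pdy (Gspray F i) m) (pdy (F2 F) l) x y)
        = ∑ m, y m * baseOp (pdy (pdy (F2 F) l) m) x y
          + ∑ m, y m * pdx (pdy (F2 F) l) m x y - ∑ m, y m * pdx (pdy (F2 F) m) l x y := by
      rw [← Finset.sum_add_distrib, ← Finset.sum_add_distrib, ← Finset.sum_sub_distrib,
        Finset.mul_sum]
      exact Finset.sum_congr rfl fun m _ => by linear_combination h1 m
    have h8 := hF.vertOp_Gspray_pdy l x hx y hy
    simp only at h8
    linarith
  have hvec : (gMat F x y).mulVec (fun i => N i x y - 2 * Gspray F i x y) = 0 := by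
    ext l
    have h := key l
    rw [hF.vertOp_pdy_F2 _ l x hx y hy, hF.vertOp_pdy_F2 _ l x hx y hy] at h
    have : (fun i => N i x y - 2 * Gspray F i x y)
        = (fun i => N i x y) - (2 : ℝ) • fun i => Gspray F i x y := rfl
    rw [this, Matrix.mulVec_sub, Matrix.mulVec_smul]
    simp only [Pi.sub_apply, Pi.smul_apply, smul_eq_mul, Pi.zero_apply]
    linarith
  have := congrFun (Matrix.eq_zero_of_mulVec_eq_zero (hF.det_ne_zero x hx y hy) hvec) i
  simp only [Pi.zero_apply] at this
  change N i x y = _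
  linarith

theorem IsFinslerMetric.euler_Ncon (hF : IsFinslerMetric U F) (i j : Fin n) :
    EqSlit U (vertOp (fun k _ y => y k) (Ncon F i j)) (Ncon F i j) := by
  intro x hx y hy
  simpa [Ncon] using euler_pdy hF.isOpen (hF.smoothSlit_Gspray i) (hF.euler_Gspray i) j x hx y hy

/-- Three vertical derivatives of the horizontal constancy of `F` along the spray. -/
theorem IsFinslerMetric.baseOp_pdy_pdy_pdy_F2 (hF : IsFinslerMetric U F) (j k l : Fin n) :
    EqSlit U (baseOp (pdy (pdy (pdy (F2 F) l) k) j)) fun x y =>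
      2 * vertOp (Gspray F) (pdy (pdy (pdy (F2 F) l) k) j) x y
        + vertOp (fun i => Ncon F i j) (pdy (pdy (F2 F) l) k) x y
        + vertOp (fun i => Ncon F i k) (pdy (pdy (F2 F) l) j) x y
        + vertOp (fun i => Ncon F i l) (pdy (pdy (F2 F) k) j) x y
        - vertOp (fun i => Bcurv F i k l j) (F2 F) x y := by
  have hU := hF.isOpen
  have hf := hF.smoothSlit_F2
  have hG := hF.smoothSlit_Gspray
  have hN : ∀ m i, SmoothSlit U (Ncon F i m) := fun m i => (hG i).pdy hU m
  have hΓ : ∀ m p i, SmoothSlit U (Γcon F i m p) := fun m p i => ((hG i).pdy hU p).pdy hU m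
  have hΓc : ∀ m p (S : Pt n → Pt n → ℝ), EqSlit U (vertOp (fun i => Γcon F i m p) S)
      (vertOp (fun i => Γcon F i p m) S) := by
    intro m p S x hx y hy
    exact Finset.sum_congr rfl fun i _ => congrArg (· * _) ((hG i).pdy_pdy_comm hU p m x hx y hy)
  have hx1 : ∀ l m, EqSlit U (pdx (pdy (F2 F) l) m) fun x y =>
      vertOp (fun i => Ncon F i m) (pdy (F2 F) l) x y
        + vertOp (fun i => Γcon F i l m) (F2 F) x y := by
    intro l m x hx y hy
    rw [← hf.pdy_pdx_comm hU m l x hx y hy, (hF.pdx_F2 m).pdy l x hx y hy,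
      pdy_vertOp hU (hN m) hf l x hx y hy]
    rfl
  have hx2 : EqSlit U (pdx (pdy (pdy (F2 F) l) k) j) fun x y =>
      vertOp (fun i => Ncon F i j) (pdy (pdy (F2 F) l) k) x y
        + vertOp (fun i => Γcon F i k j) (pdy (F2 F) l) x y
        + (vertOp (fun i => Γcon F i l j) (pdy (F2 F) k) x y
        + vertOp (fun i => Bcurv F i k l j) (F2 F) x y) := by
    intro x hx y hy
    rw [← (hf.pdy hU l).pdy_pdx_comm hU j k x hx y hy, (hx1 l j).pdy k x hx y hy,
      ((hf.pdy hU l).vertOp hU (hN j)).pdy_add (hf.vertOp hU (hΓ l j)) k x hx y hy]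
    simp only [pdy_vertOp hU (hN j) (hf.pdy hU l) k x hx y hy,
      pdy_vertOp hU (hΓ l j) hf k x hx y hy]
    rfl
  have hb1 : ∀ l, EqSlit U (baseOp (pdy (F2 F) l)) fun x y =>
      2 * vertOp (Gspray F) (pdy (F2 F) l) x y + vertOp (fun i => Ncon F i l) (F2 F) x y := by
    intro l x hx y hy
    have h := hF.vertOp_Gspray_pdy l x hx y hy
    simp only [hF.pdx_F2 l x hx y hy] at h
    linarith
  have hb2 : EqSlit U (baseOp (pdy (pdy (F2 F) l) k)) fun x y =>
      2 * vertOp (Gspray F) (pdy (pdy (F2 F) l) k) x y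
        + (vertOp (fun i => Ncon F i k) (pdy (F2 F) l) x y
        + vertOp (fun i => Ncon F i l) (pdy (F2 F) k) x y) := by
    intro x hx y hy
    have h := (hb1 l).pdy k x hx y hy
    rw [pdy_baseOp hU (hf.pdy hU l) k x hx y hy,
      ((smoothSlit_const 2).mul ((hf.pdy hU l).vertOp hU hG)).pdy_add (hf.vertOp hU (hN l))
        k x hx y hy] at h
    simp only [((hf.pdy hU l).vertOp hU hG).pdy_const_mul 2 k x hx y hy,
      pdy_vertOp hU hG (hf.pdy hU l) k x hx y hy, pdy_vertOp hU (hN l) hf k x hx y hy,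
      hx1 l k x hx y hy, hΓc l k _ x hx y hy] at h
    simp only [Ncon, Γcon] at h ⊢
    linarith
  intro x hx y hy
  have hfl := hf.pdy hU l
  have hfk := hf.pdy hU k
  have hflk := hfl.pdy hU k
  have h := hb2.pdy j x hx y hy
  rw [pdy_baseOp hU hflk j x hx y hy,
    ((smoothSlit_const 2).mul (hflk.vertOp hU hG)).pdy_add
      ((hfl.vertOp hU (hN k)).add (hfk.vertOp hU (hN l))) j x hx y hy] at h
  simp only [(hflk.vertOp hU hG).pdy_const_mul 2 j x hx y hy,
    (hfl.vertOp hU (hN k)).pdy_add (hfk.vertOp hU (hN l)) j x hx y hy,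
    pdy_vertOp hU hG hflk j x hx y hy, pdy_vertOp hU (hN k) hfl j x hx y hy,
    pdy_vertOp hU (hN l) hfk j x hx y hy, hx2 x hx y hy, hΓc k j _ x hx y hy,
    hΓc l j _ x hx y hy] at h
  simp only [Ncon, Γcon] at h ⊢
  linarith

theorem IsFinslerMetric.sum_Γcon_mul_s2 (hF : IsFinslerMetric U F) (j : Fin n)
    (T : Pt n → Pt n → ℝ) :
    EqSlit U (fun x y => ∑ m, y m * vertOp (fun i => Γcon F i j m) T x y)
      (vertOp (fun i => Ncon F i j) T) := by
  intro x hx y hy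
  simp only [vertOp, Finset.mul_sum]
  rw [Finset.sum_comm]
  refine Finset.sum_congr rfl fun i _ => ?_
  rw [← hF.euler_Ncon i j x hx y hy]
  simp only [vertOp, Finset.sum_mul]
  refine Finset.sum_congr rfl fun m _ => ?_
  rw [Γcon, (hF.smoothSlit_Gspray i).pdy_pdy_comm hF.isOpen m j x hx y hy, Ncon]
  ring

theorem IsFinslerMetric.sum_Ncon_mul (hF : IsFinslerMetric U F) (T : Pt n → Pt n → ℝ) :
    EqSlit U (fun x y => ∑ m, y m * vertOp (fun i => Ncon F i m) T x y)
      fun x y => 2 * vertOp (Gspray F) T x y := by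
  intro x hx y hy
  simp only [vertOp, Finset.mul_sum]
  rw [Finset.sum_comm]
  refine Finset.sum_congr rfl fun i _ => ?_
  have h := hF.euler_Gspray i x hx y hy
  simp only [vertOp] at h
  calc _ = (∑ m, y m * pdy (Gspray F i) m x y) * pdy T i x y := by
          rw [Finset.sum_mul]
          exact Finset.sum_congr rfl fun m _ => by rw [Ncon]; ring
    _ = _ := by rw [h]; ring

theorem IsFinslerMetric.Land_eq_ops (hF : IsFinslerMetric U F) (j k l : Fin n) :
    EqSlit U (Land F j k l) fun x y => (1 / 4 : ℝ) *
      (baseOp (pdy (pdy (pdy (F2 F) l) k) j) x y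
        - 2 * vertOp (Gspray F) (pdy (pdy (pdy (F2 F) l) k) j) x y
        - vertOp (fun i => Ncon F i j) (pdy (pdy (F2 F) l) k) x y
        - vertOp (fun i => Ncon F i k) (pdy (pdy (F2 F) l) j) x y
        - vertOp (fun i => Ncon F i l) (pdy (pdy (F2 F) k) j) x y) := by
  have hU := hF.isOpen
  have hf := hF.smoothSlit_F2
  have hfl := hf.pdy hU l
  have hC := (hfl.pdy hU k).pdy hU j
  intro x hx y hy
  have hN := hF.sum_Ncon_mul (pdy (pdy (pdy (F2 F) l) k) j) x hx y hy
  beta_reduce at hN ⊢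
  rw [← hF.sum_Γcon_mul_s2 j _ x hx y hy, ← hF.sum_Γcon_mul_s2 k _ x hx y hy,
    ← hF.sum_Γcon_mul_s2 l _ x hx y hy, ← hN]
  simp only [baseOp, ← Finset.sum_sub_distrib, Finset.mul_sum, Land]
  refine Finset.sum_congr rfl fun m _ => ?_
  have e0 : pdx (Cartan F j k l) m x y = (1 / 4 : ℝ) * pdx (pdy (pdy (pdy (F2 F) l) k) j) m x y :=
    hC.pdx_const_mul _ m x hx y hy
  have e1 : ∀ r, pdy (Cartan F j k l) r x y
      = (1 / 4 : ℝ) * pdy (pdy (pdy (pdy (F2 F) l) k) j) r x y :=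
    fun r => hC.pdy_const_mul _ r x hx y hy
  have e2 : ∀ r, Cartan F j r l x y = (1 / 4 : ℝ) * pdy (pdy (pdy (F2 F) l) j) r x y :=
    fun r => congrArg _ (hfl.pdy_pdy_comm hU r j x hx y hy)
  have e3 : ∀ r, Cartan F j k r x y = (1 / 4 : ℝ) * pdy (pdy (pdy (F2 F) k) j) r x y :=
    fun r => congrArg _ (((hf.pdy_pdy_comm hU r k).pdy j x hx y hy).trans
      ((hf.pdy hU k).pdy_pdy_comm hU r j x hx y hy))
  have swap : ∀ (A B : Fin n → ℝ), ∑ r, (1 / 4 : ℝ) * A r * B r = 1 / 4 * ∑ r, B r * A r := by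
    intro A B
    rw [Finset.mul_sum]
    exact Finset.sum_congr rfl fun r _ => by ring
  have swap' : ∀ (A B : Fin n → ℝ), ∑ r, B r * ((1 / 4 : ℝ) * A r) = 1 / 4 * ∑ r, B r * A r := by
    intro A B
    rw [Finset.mul_sum]
    exact Finset.sum_congr rfl fun r _ => by ring
  simp only [hD3, hD0, e0, e1, e2, e3, vertOp]
  rw [swap', swap, swap]
  have e4 : ∑ r, Cartan F r k l x y * Γcon F r j m x y
      = 1 / 4 * ∑ r, Γcon F r j m x y * pdy (pdy (pdy (F2 F) l) k) r x y := swap _ _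
  rw [e4]
  ring

theorem IsFinslerMetric.pdy_F2 (hF : IsFinslerMetric U F) (i : Fin n) :
    EqSlit U (pdy (F2 F) i) fun x y => 2 * yLow F i x y := by
  intro x hx y hy
  rw [← hF.euler_pdy_F2 i x hx y hy]
  simp only [vertOp, yLow, Finset.mul_sum]
  refine Finset.sum_congr rfl fun j _ => ?_
  rw [hF.gLow_comm i j x hx y hy, gLow]
  ring

/-- The Landsberg curvature is `-1/2` times the Berwald curvature contracted with `y_i`. -/
theorem IsFinslerMetric.Land_eq (hF : IsFinslerMetric U F) (j k l : Fin n) :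
    EqSlit U (Land F j k l) fun x y =>
      -(1 / 2 : ℝ) * ∑ i, yLow F i x y * Bcurv F i k l j x y := by
  intro x hx y hy
  have h1 := hF.Land_eq_ops j k l x hx y hy
  have h2 := hF.baseOp_pdy_pdy_pdy_F2 j k l x hx y hy
  have h3 : vertOp (fun i => Bcurv F i k l j) (F2 F) x y
      = 2 * ∑ i, yLow F i x y * Bcurv F i k l j x y := by
    rw [vertOp, Finset.mul_sum]
    refine Finset.sum_congr rfl fun i _ => ?_
    rw [hF.pdy_F2 i x hx y hy]
    ring
  simp only at h1 h2 ⊢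
  linarith

theorem IsFinslerMetric.sum_yLow_mul_self (hF : IsFinslerMetric U F) :
    EqSlit U (fun x y => ∑ i, yLow F i x y * y i) fun x y => F x y ^ 2 := by
  intro x hx y hy
  have h := hF.euler_F2 x hx y hy
  have h2 : vertOp (fun k _ y => y k) (F2 F) x y = 2 * ∑ i, yLow F i x y * y i := by
    rw [vertOp, Finset.mul_sum]
    refine Finset.sum_congr rfl fun i _ => ?_
    rw [hF.pdy_F2 i x hx y hy]
    ring
  simp only [F2] at h h2 ⊢
  linarith

theorem IsFinslerMetric.sum_yLow_mul_ell (hF : IsFinslerMetric U F) :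
    EqSlit U (fun x y => ∑ i, yLow F i x y * ell F i x y) F := by
  intro x hx y hy
  have hp := (hF.pos x hx y hy).ne'
  have h := hF.sum_yLow_mul_self x hx y hy
  simp only [ell, mul_div_assoc', ← Finset.sum_div] at h ⊢
  rw [h]
  field_simp

theorem IsFinslerMetric.sum_yLow_mul_hUp (hF : IsFinslerMetric U F) (j : Fin n) :
    EqSlit U (fun x y => ∑ i, yLow F i x y * hUp F i j x y) fun _ _ => 0 := by
  intro x hx y hy
  have hp := (hF.pos x hx y hy).ne'
  have h := hF.sum_yLow_mul_self x hx y hy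
  simp only at h
  have h2 : ∑ i, yLow F i x y * (y i * yLow F j x y / F x y ^ 2) = yLow F j x y := by
    calc _ = (∑ i, yLow F i x y * y i) * (yLow F j x y / F x y ^ 2) := by
            rw [Finset.sum_mul]
            exact Finset.sum_congr rfl fun i _ => by ring
      _ = _ := by rw [h]; field_simp
  simp only [hUp, mul_sub, Finset.sum_sub_distrib, h2]
  simp

theorem IsFinslerMetric.Cartan_cycle (hF : IsFinslerMetric U F) (j k l : Fin n) :
    EqSlit U (Cartan F k l j) (Cartan F j k l) := fun x hx y hy =>
  congrArg (1 / 4 * ·) (((hF.smoothSlit_F2.pdy_pdy_comm hF.isOpen j l).pdy k x hx y hy).trans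
    ((hF.smoothSlit_F2.pdy hF.isOpen l).pdy_pdy_comm hF.isOpen j k x hx y hy))

end Finsler

/-- For a generalized isotropic Berwald metric, `L_{jkl} = -(1/2) μ F C_{jkl}`. -/
theorem gib_landsberg_eq {n : ℕ} (U : Set (Pt n)) (F μ lam : Pt n → Pt n → ℝ)
    (hF : IsGIB U F μ lam) :
    ∀ x ∈ U, ∀ y : Pt n, y ≠ 0 → ∀ j k l : Fin n,
      Land F j k l x y = -(1 / 2 : ℝ) * μ x y * F x y * Cartan F j k l x y := by
  intro x hx y hy j k l
  have hM := hF.finsler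
  have h1 := hM.sum_yLow_mul_hUp k x hx y hy
  have h2 := hM.sum_yLow_mul_hUp l x hx y hy
  have h3 := hM.sum_yLow_mul_hUp j x hx y hy
  have h4 := hM.sum_yLow_mul_ell x hx y hy
  simp only at h1 h2 h3 h4
  have key : ∑ i, yLow F i x y * Bcurv F i k l j x y
      = μ x y * Cartan F k l j x y * ∑ i, yLow F i x y * ell F i x y
        + lam x y * ((∑ i, yLow F i x y * hUp F i k x y) * hLow F l j x y
          + (∑ i, yLow F i x y * hUp F i l x y) * hLow F k j x y
          + (∑ i, yLow F i x y * hUp F i j x y) * hLow F k l x y) := by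
    simp only [Finset.sum_mul, ← Finset.sum_add_distrib, Finset.mul_sum]
    refine Finset.sum_congr rfl fun i _ => ?_
    rw [hF.berwald x hx y hy i k l j]
    ring
  rw [hM.Land_eq j k l x hx y hy]
  beta_reduce
  rw [key, h1, h2, h3, h4, hM.Cartan_cycle j k l x hx y hy]
  ring
end
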